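/- arXiv:0709.1935 — 12 statements merged into one kernel-verified Lean document; each statement's English description precedes it below -/
import Mathlib

section
/- For every positive integer n, every unit interval graph on n vertices is an induced subgraph of the canonical graph H_{n,n} (i.e., H_{n,n} is an n-universal unit interval graph). -/
open SimpleGraph

/-- A graph is a unit interval graph if there is a map `f` to the reals such that
distinct vertices `u, v` are adjacent iff `|f u - f v| ≤ 1`. -/
def IsUnitInterval {V : Type*} (G : SimpleGraph V) : Prop :=
  ∃ f : V → ℝ, ∀ u v : V, u ≠ v → (G.Adj u v ↔ |f u - f v| ≤ 1)

/-- The canonical unit interval graph `H_{n,m}` on vertex set `Fin n × Fin m`: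
rows are cliques, and a vertex in row `i+1`, column `j'` is adjacent to a vertex in
row `i`, column `j` iff `j' ≤ j`. -/
def canonicalGraph (n m : ℕ) : SimpleGraph (Fin n × Fin m) where
  Adj p q := p ≠ q ∧ (p.1 = q.1 ∨
      ((q.1 : ℕ) = (p.1 : ℕ) + 1 ∧ (q.2 : ℕ) ≤ (p.2 : ℕ)) ∨
      ((p.1 : ℕ) = (q.1 : ℕ) + 1 ∧ (p.2 : ℕ) ≤ (q.2 : ℕ)))
  symm := by
    constructor
    rintro p q ⟨hne, h⟩
    refine ⟨hne.symm, ?_⟩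
    tauto
  loopless := by constructor; rintro p ⟨hne, -⟩; exact hne rfl

/-- Syntactic expressions for clique-width constructions with `k` labels. -/
inductive CWExpr (k : ℕ) : Type where
  | single (i : Fin k) : CWExpr k
  | union (e₁ e₂ : CWExpr k) : CWExpr k
  | join (i j : Fin k) (hij : i ≠ j) (e : CWExpr k) : CWExpr k
  | relabel (i j : Fin k) (e : CWExpr k) : CWExpr k

namespace CWExpr

/-- The vertex type of the graph constructed by an expression. -/
def V {k : ℕ} : CWExpr k → Type
  | single _ => Unit
  | union e₁ e₂ => e₁.V ⊕ e₂.V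
  | join _ _ _ e => e.V
  | relabel _ _ e => e.V

/-- The final labelling of the vertices. -/
def label {k : ℕ} : (e : CWExpr k) → e.V → Fin k
  | single i, _ => i
  | union e₁ _, Sum.inl v => e₁.label v
  | union _ e₂, Sum.inr v => e₂.label v
  | join _ _ _ e, v => e.label v
  | relabel i j e, v => if e.label v = i then j else e.label v

/-- The graph constructed by an expression. -/
def graph {k : ℕ} : (e : CWExpr k) → SimpleGraph e.V
  | single _ => ⊥
  | union e₁ e₂ => e₁.graph ⊕g e₂.graph
  | join i j _ e => e.graph ⊔ SimpleGraph.fromRel (fun u v => e.label u = i ∧ e.label v = j)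
  | relabel _ _ e => e.graph

end CWExpr

/-- `G` has clique-width at most `k`: it is isomorphic to the graph of some
clique-width expression with `k` labels. -/
def CliqueWidthLE {V : Type*} (G : SimpleGraph V) (k : ℕ) : Prop :=
  ∃ e : CWExpr k, Nonempty (G ≃g e.graph)

/-- `U`-similarity: two vertices of `U` are similar if they have the same
neighbourhood outside `U`. -/
def similarSetoid {V : Type*} (G : SimpleGraph V) (U : Set V) : Setoid ↥U where
  r u v := ∀ w ∉ U, (G.Adj u w ↔ G.Adj v w)
  iseqv := ⟨fun _ _ _ => Iff.rfl, fun h w hw => (h w hw).symm,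
    fun h₁ h₂ w hw => (h₁ w hw).trans (h₂ w hw)⟩

/-- `μ_G(U)`: the number of `U`-similarity classes. -/
noncomputable def mu {V : Type*} (G : SimpleGraph V) (U : Set V) : ℕ :=
  Nat.card (Quotient (similarSetoid G U))

section UnitRow

variable {V : Type*} [Fintype V]

theorem card_filter_lt_card_filter (f : V → ℝ) {u v : V} (h : f u < f v) :
    (Finset.univ.filter fun w => f w < f u).card <
      (Finset.univ.filter fun w => f w < f v).card := by
  refine Finset.card_lt_card ⟨fun w hw => ?_, fun hs => ?_⟩
  · simp only [Finset.mem_filter, Finset.mem_univ, true_and] at hw ⊢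
    exact hw.trans h
  · simpa using hs (Finset.mem_filter.2 ⟨Finset.mem_univ u, h⟩)

/-- The row of `v`: one less than the largest size of a set of points with values at most `f v`,
containing `v`, any two of whose values differ by more than one. -/
noncomputable def unitRow (f : V → ℝ) (v : V) : ℕ :=
  Finset.univ.sup fun w => if h : f w + 1 < f v then unitRow f w + 1 else 0
termination_by (Finset.univ.filter fun w => f w < f v).card
decreasing_by exact card_filter_lt_card_filter f (by linarith)

theorem unitRow_eq_sup (f : V → ℝ) (v : V) : unitRow f v =
    Finset.univ.sup fun w => if f w + 1 < f v then unitRow f w + 1 else 0 := by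
  rw [unitRow]
  simp

theorem unitRow_lt_unitRow (f : V → ℝ) {u v : V} (h : f u + 1 < f v) :
    unitRow f u < unitRow f v := by
  rw [unitRow_eq_sup f v]
  have := Finset.le_sup (f := fun w => if f w + 1 < f v then unitRow f w + 1 else 0)
    (Finset.mem_univ u)
  simpa [h] using this

theorem exists_unitRow_eq_add_one (f : V → ℝ) {v : V} (hv : unitRow f v ≠ 0) :
    ∃ w, f w + 1 < f v ∧ unitRow f v = unitRow f w + 1 := by
  obtain ⟨w, -, hw⟩ := Finset.exists_mem_eq_sup Finset.univ ⟨v, Finset.mem_univ v⟩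
    fun w => if f w + 1 < f v then unitRow f w + 1 else 0
  rw [← unitRow_eq_sup f v] at hw
  by_cases h : f w + 1 < f v
  · exact ⟨w, h, by simpa [h] using hw⟩
  · exact absurd (by simpa [h] using hw) hv

theorem unitRow_mono (f : V → ℝ) {u v : V} (h : f u ≤ f v) : unitRow f u ≤ unitRow f v := by
  by_cases hu : unitRow f u = 0
  · omega
  · obtain ⟨w, hw, hr⟩ := exists_unitRow_eq_add_one f hu
    have := unitRow_lt_unitRow f (hw.trans_le h)
    omega

theorem lt_of_unitRow_lt (f : V → ℝ) {u v : V} (h : unitRow f u < unitRow f v) : f u < f v := by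
  contrapose! h
  exact unitRow_mono f h

theorem add_one_lt_of_unitRow_add_two_le (f : V → ℝ) {u v : V}
    (h : unitRow f u + 2 ≤ unitRow f v) : f u + 1 < f v := by
  obtain ⟨w, hw, hr⟩ := exists_unitRow_eq_add_one f (v := v) (by omega)
  have := lt_of_unitRow_lt f (u := u) (v := w) (by omega)
  linarith

theorem le_add_one_of_unitRow_le (f : V → ℝ) {u v : V} (h : unitRow f v ≤ unitRow f u) :
    f v ≤ f u + 1 := by
  contrapose! h
  exact unitRow_lt_unitRow f h

theorem unitRow_le_card (f : V → ℝ) (v : V) :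
    unitRow f v ≤ (Finset.univ.filter fun w => f w < f v).card := by
  induction hr : unitRow f v generalizing v with
  | zero => exact Nat.zero_le _
  | succ k ih =>
    obtain ⟨w, hw, hr'⟩ := exists_unitRow_eq_add_one f (v := v) (by omega)
    exact (ih w (by omega)).trans_lt (card_filter_lt_card_filter f (by linarith))

theorem unitRow_lt_card (f : V → ℝ) (v : V) : unitRow f v < Fintype.card V :=
  (unitRow_le_card f v).trans_lt <| Finset.card_lt_univ_of_notMem (x := v) (by simp)

end UnitRow

theorem exists_fin_equiv_le_iff {V α : Type*} [Fintype V] [LinearOrder α] {n : ℕ}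
    (hcard : Fintype.card V = n) {key : V → α} (hkey : Function.Injective key) :
    ∃ c : V ≃ Fin n, ∀ u v, c u ≤ c v ↔ key u ≤ key v := by
  let : LinearOrder V := LinearOrder.lift' key hkey
  exact ⟨(monoEquivOfFin V hcard).symm.toEquiv, fun u v => (monoEquivOfFin V hcard).symm.le_iff_le⟩

/-- Columns order the vertices by `f v - unitRow f v`, ties being broken in favour of higher
rows. -/
theorem exists_column {V : Type*} [Fintype V] {n : ℕ} (hcard : Fintype.card V = n) (f : V → ℝ) :
    ∃ c : V ≃ Fin n, ∀ u v, unitRow f v = unitRow f u + 1 → (c v ≤ c u ↔ f v ≤ f u + 1) := by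
  obtain ⟨c, hc⟩ := exists_fin_equiv_le_iff hcard
    (key := fun v => toLex (f v - unitRow f v,
      toLex (OrderDual.toDual (unitRow f v), Fintype.equivFin V v)))
    fun u v h => by simp_all
  refine ⟨c, fun u v h => ?_⟩
  have hlt : OrderDual.toDual (unitRow f v) < OrderDual.toDual (unitRow f u) :=
    OrderDual.toDual_lt_toDual.2 (by omega)
  rw [hc, Prod.Lex.toLex_le_toLex, Prod.Lex.toLex_le_toLex]
  simp only [hlt, true_or, and_true, ← le_iff_lt_or_eq]
  rw [h]
  push_cast
  constructor <;> intro h <;> linarith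

/-- `H_{n,n}` is an `n`-universal unit interval graph: every unit
interval graph on `n` vertices embeds into `H_{n,n}` as an induced subgraph. -/
theorem canonicalGraph_nUniversal_unitInterval (n : ℕ) (hn : 0 < n)
    (V : Type) [Fintype V] (G : SimpleGraph V) (hcard : Fintype.card V = n)
    (hG : IsUnitInterval G) :
    Nonempty (G ↪g canonicalGraph n n) := by
  obtain ⟨f, hf⟩ := hG
  obtain ⟨c, hc⟩ := exists_column hcard f
  have hinj : Function.Injective fun v : V =>
      ((⟨unitRow f v, hcard ▸ unitRow_lt_card f v⟩, c v) : Fin n × Fin n) :=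
    fun u v h => c.injective (congrArg Prod.snd h)
  refine ⟨⟨⟨_, hinj⟩, fun {u v} => ?_⟩⟩
  by_cases huv : u = v
  · subst huv
    simp
  rw [hf u v huv, abs_le]
  simp only [canonicalGraph, Function.Embedding.coeFn_mk, ne_eq, hinj.eq_iff, huv,
    not_false_eq_true, true_and, Fin.mk.injEq, Fin.val_fin_le]
  have key {a b : V} (h : unitRow f a < unitRow f b) :
      f b ≤ f a + 1 ↔ unitRow f b = unitRow f a + 1 ∧ c b ≤ c a := by
    by_cases hs : unitRow f b = unitRow f a + 1
    · simp [hs, hc a b hs]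
    · simpa [hs] using add_one_lt_of_unitRow_add_two_le f (u := a) (v := b) (by omega)
  rcases lt_trichotomy (unitRow f u) (unitRow f v) with h | h | h
  · have hle := le_add_one_of_unitRow_le f h.le
    rw [← key h]
    constructor
    · rintro (h' | h' | h')
      · omega
      · constructor <;> linarith
      · omega
    · exact fun h' => Or.inr (Or.inl (by linarith))
  · have huv := le_add_one_of_unitRow_le f h.le
    have hvu := le_add_one_of_unitRow_le f h.ge
    exact ⟨fun _ => by constructor <;> linarith, fun _ => Or.inl h⟩
  · have hle := le_add_one_of_unitRow_le f h.le
    rw [← key h]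
    constructor
    · rintro (h' | h' | h')
      · omega
      · omega
      · constructor <;> linarith
    · exact fun h' => Or.inr (Or.inr (by linarith))
end

section
/- For all positive integers s and t, the clique-width of the canonical graph H_{s,t} is at most 3s. -/
open SimpleGraph

/-- `S` is constructible: the subgraph of `G` induced on `S` is the graph of a clique-width
expression whose labelling is the restriction of `l`. -/
def CWConstructible {V : Type*} {k : ℕ} (G : SimpleGraph V) (l : V → Fin k) (S : Set V) : Prop :=
  ∃ (e : CWExpr k) (φ : e.V → V), Function.Injective φ ∧ Set.range φ = S ∧
    (∀ u v, e.graph.Adj u v ↔ G.Adj (φ u) (φ v)) ∧ ∀ u, e.label u = l (φ u)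

namespace CWConstructible

variable {V : Type*} {k : ℕ} {G : SimpleGraph V} {l : V → Fin k} {S : Set V}

theorem singleton (x : V) : CWConstructible G l {x} := by
  refine ⟨.single (l x), fun _ => x, fun _ _ _ => rfl, ?_, fun u v => ?_, fun _ => rfl⟩
  · ext y
    exact ⟨fun ⟨_, h⟩ => h.symm, fun h => ⟨(), h.symm⟩⟩
  · simp [CWExpr.graph]

/-- A vertex whose neighbours in `S` are the vertices carrying its own label or the label `b`
can be added with the help of an auxiliary label `c`. -/
theorem insert {x : V} {b c : Fin k} (hS : CWConstructible G l S) (hx : x ∉ S)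
    (hc : ∀ v, l v ≠ c) (hbc : c ≠ b)
    (hadj : ∀ v ∈ S, G.Adj v x ↔ l v = l x ∨ l v = b) :
    CWConstructible G l (insert x S) := by
  obtain ⟨e, φ, hinj, rfl, hG, hl⟩ := hS
  refine ⟨.relabel c (l x) (.join c b hbc (.join c (l x) (hc x).symm (.union e (.single c)))),
    Sum.elim φ fun _ => x, ?_, ?_, ?_, ?_⟩
  · exact hinj.sumElim (fun _ _ _ => rfl) fun a _ h => hx ⟨a, h⟩
  · ext y
    constructor
    · rintro ⟨u | u, rfl⟩
      · exact Or.inr ⟨u, rfl⟩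
      · exact Or.inl rfl
    · rintro (rfl | ⟨u, rfl⟩)
      · exact ⟨Sum.inr (), rfl⟩
      · exact ⟨Sum.inl u, rfl⟩
  · have key (u : e.V) : G.Adj (φ u) x ↔ l (φ u) = l x ∨ l (φ u) = b := hadj _ ⟨u, rfl⟩
    rintro (u | u) (v | v)
    · change (e.graph.Adj u v ∨ (Sum.inl u : e.V ⊕ Unit) ≠ Sum.inl v ∧
          (e.label u = c ∧ e.label v = l x ∨ e.label v = c ∧ e.label u = l x)) ∨
        (Sum.inl u : e.V ⊕ Unit) ≠ Sum.inl v ∧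
          (e.label u = c ∧ e.label v = b ∨ e.label v = c ∧ e.label u = b) ↔ G.Adj (φ u) (φ v)
      simp [hl, hc, hG]
    · change ((e.graph ⊕g (⊥ : SimpleGraph Unit)).Adj (Sum.inl u) (Sum.inr ()) ∨
          (Sum.inl u : e.V ⊕ Unit) ≠ Sum.inr () ∧
            (e.label u = c ∧ c = l x ∨ c = c ∧ e.label u = l x)) ∨
        (Sum.inl u : e.V ⊕ Unit) ≠ Sum.inr () ∧
            (e.label u = c ∧ c = b ∨ c = c ∧ e.label u = b) ↔ G.Adj (φ u) x
      simp [hl, hc, key]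
    · change ((e.graph ⊕g (⊥ : SimpleGraph Unit)).Adj (Sum.inr ()) (Sum.inl v) ∨
          (Sum.inr () : e.V ⊕ Unit) ≠ Sum.inl v ∧
            (c = c ∧ e.label v = l x ∨ e.label v = c ∧ c = l x)) ∨
        (Sum.inr () : e.V ⊕ Unit) ≠ Sum.inl v ∧
          (c = c ∧ e.label v = b ∨ e.label v = c ∧ c = b) ↔ G.Adj x (φ v)
      simp [hl, hc, key, G.adj_comm x]
    · obtain rfl : u = v := rfl
      exact iff_of_false (SimpleGraph.irrefl _) (SimpleGraph.irrefl _)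
  · rintro (u | u)
    · change (if e.label u = c then l x else e.label u) = l (φ u)
      simp [hl, hc]
    · change (if c = c then l x else c) = l x
      simp

theorem cliqueWidthLE (h : CWConstructible G l Set.univ) : CliqueWidthLE G k := by
  obtain ⟨e, φ, hinj, hr, hG, -⟩ := h
  exact ⟨e, ⟨RelIso.symm
    ⟨Equiv.ofBijective φ ⟨hinj, Set.range_eq_univ.mp hr⟩, fun {u v} => (hG u v).symm⟩⟩⟩

end CWConstructible

/-- If `q` precedes `p` in the order by increasing column and decreasing row, then the two are
adjacent in the canonical graph iff `q` lies in the row of `p` or in the next one. -/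
theorem canonicalGraph_adj_of_le {n m : ℕ} {p q : Fin n × Fin m} (hne : q ≠ p)
    (hle : toLex (q.2, OrderDual.toDual q.1) ≤ toLex (p.2, OrderDual.toDual p.1)) :
    (canonicalGraph n m).Adj q p ↔ (q.1 : ℕ) = p.1 ∨ (q.1 : ℕ) = p.1 + 1 := by
  obtain ⟨i, j⟩ := p
  obtain ⟨i', j'⟩ := q
  simp only [Prod.Lex.toLex_le_toLex, OrderDual.toDual_le_toDual, Fin.lt_def, Fin.le_def,
    Fin.ext_iff] at hle
  simp only [canonicalGraph, ne_eq, Prod.mk.injEq, Fin.ext_iff] at hne ⊢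
  omega

/-- The clique-width of the canonical graph `H_{s,t}` is at most `3 s`. -/
theorem cliqueWidth_canonicalGraph_le (s t : ℕ) (hs : 0 < s) (ht : 0 < t) :
    CliqueWidthLE (canonicalGraph s t) (3 * s) := by
  classical
  let l : Fin s × Fin t → Fin (3 * s) := fun p => ⟨p.1, by omega⟩
  have main : ∀ S : Finset (Fin s × Fin t), S.Nonempty →
      CWConstructible (canonicalGraph s t) l S := by
    intro S
    induction S using Finset.induction_on_max_value
      (fun p : Fin s × Fin t => toLex (p.2, OrderDual.toDual p.1)) with
    | empty => simp
    | insert x S hx hmax ih =>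
      intro _
      rcases S.eq_empty_or_nonempty with rfl | hne
      · simpa using CWConstructible.singleton x
      · rw [Finset.coe_insert]
        refine (ih hne).insert (b := ⟨x.1 + 1, by omega⟩) (c := ⟨s + 1, by omega⟩)
          (by simpa using hx) (fun v => ?_) ?_ fun v hv => ?_
        · simp only [l, ne_eq, Fin.ext_iff]
          omega
        · simp only [ne_eq, Fin.ext_iff]
          omega
        · rw [canonicalGraph_adj_of_le (ne_of_mem_of_not_mem hv hx) (hmax v hv)]
          simp [l, Fin.ext_iff]
  have huniv := main Finset.univ ⟨(⟨0, hs⟩, ⟨0, ht⟩), Finset.mem_univ _⟩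
  rw [Finset.coe_univ] at huniv
  exact huniv.cliqueWidthLE
end

section
/- A finite connected simple graph G is a unit interval graph if and only if its vertex set can be partitioned into cliques Q_0, Q_1, …, Q_t such that: (a) any two vertices lying in cliques Q_i and Q_j with |i − j| ≥ 2 are non-adjacent; (b) for each j ∈ {1,…,t} and all u, v ∈ Q_j, the sets N(u) ∩ Q_{j−1} and N(v) ∩ Q_{j−1} are comparable under inclusion; (c) for each j ∈ {1,…,t−1} there is a linear order on Q_j such that if u precedes v then N(v) ∩ Q_{j−1} ⊆ N(u) ∩ Q_{j−1} and N(u) ∩ Q_{j+1} ⊆ N(v) ∩ Q_{j+1}. -/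
open SimpleGraph

/-- Every map to a linear order is monotone for some linear order on its domain. -/
theorem exists_linearOrder_monotone {α β : Type*} [LinearOrder β] (g : α → β) :
    ∃ _ : LinearOrder α, Monotone g := by
  classical
  let _ : LinearOrder α := linearOrderOfSTO WellOrderingRel
  let key : α → β ×ₗ α := fun a => toLex (g a, a)
  have hkey : Function.Injective key := fun a b h => congrArg (fun p => (ofLex p).2) h
  refine ⟨LinearOrder.lift' key hkey, fun a b (hab : key a ≤ key b) => ?_⟩
  exact (Prod.Lex.toLex_le_toLex.1 hab).elim le_of_lt fun h => h.1.le

/-- A preorder which is total on a finite set is given by comparing integer keys. -/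
theorem exists_key_of_total {α : Type*} [Finite α] (s : Set α) (r : α → α → Prop)
    (total : ∀ u ∈ s, ∀ v ∈ s, r u v ∨ r v u)
    (trans : ∀ u ∈ s, ∀ v ∈ s, ∀ w ∈ s, r u v → r v w → r u w) :
    ∃ k : α → ℤ, ∀ u ∈ s, ∀ v ∈ s, k u ≤ k v → r u v := by
  refine ⟨fun u => ({w | w ∈ s ∧ r w u}.ncard : ℤ), fun u hu v hv huv => ?_⟩
  by_contra hn
  have hvu : r v u := (total u hu v hv).resolve_left hn
  have huu : r u u := or_self_iff.1 (total u hu u hu)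
  have hlt : {w | w ∈ s ∧ r w v}.ncard < {w | w ∈ s ∧ r w u}.ncard := by
    refine Set.ncard_lt_ncard ?_ (Set.toFinite _)
    refine ⟨fun w hw => ⟨hw.1, trans w hw.1 v hv u hu hw.2 hvu⟩, fun hsub => ?_⟩
    exact hn (hsub (show u ∈ s ∧ r u u from ⟨hu, huu⟩)).2
  have : ({w | w ∈ s ∧ r w u}.ncard : ℤ) ≤ {w | w ∈ s ∧ r w v}.ncard := huv
  omega

/-- A finite graph whose vertices can be ordered so that every edge `u w` makes all vertices
between `u` and `w` adjacent to both ends is a unit interval graph. -/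
theorem isUnitInterval_of_umbrella {V : Type*} [Finite V] [LinearOrder V] (G : SimpleGraph V)
    (h : ∀ u v w : V, u < v → v < w → G.Adj u w → G.Adj u v ∧ G.Adj v w) :
    IsUnitInterval G := by
  classical
  have := Fintype.ofFinite V
  have key : ∀ s : Finset V, ∃ f : V → ℝ, ∀ u ∈ s, ∀ v ∈ s, u < v →
      f u < f v ∧ (G.Adj u v → f v < f u + 1) ∧ (¬ G.Adj u v → f u + 1 < f v) := by
    intro s
    induction s using Finset.induction_on_max with
    | empty => exact ⟨0, by simp⟩
    | insert a s ha ih =>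
      obtain ⟨f, hf⟩ := ih
      obtain ⟨m, hlo, hhi⟩ := Order.exists_between_finsets
        (s.image f ∪ ({x ∈ s | ¬ G.Adj x a}).image (fun x => f x + 1))
        (({y ∈ s | G.Adj y a}).image (fun y => f y + 1)) (by
          intro p hp q hq
          simp only [Finset.mem_union, Finset.mem_image, Finset.mem_filter] at hp hq
          obtain ⟨y, ⟨hy, hya⟩, rfl⟩ := hq
          rcases hp with ⟨x, hx, rfl⟩ | ⟨x, ⟨hx, hxa⟩, rfl⟩
          · rcases lt_trichotomy x y with hxy | rfl | hxy
            · linarith [(hf x hx y hy hxy).1]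
            · linarith
            · exact (hf y hy x hx hxy).2.1 (h y x a hxy (ha x hx) hya).1
          · rcases lt_trichotomy x y with hxy | rfl | hxy
            · linarith [(hf x hx y hy hxy).1]
            · exact absurd hya hxa
            · exact absurd (h y x a hxy (ha x hx) hya).2 hxa)
      refine ⟨Function.update f a m, fun u hu v hv huv => ?_⟩
      rcases Finset.mem_insert.1 hu with rfl | hus
      · rcases Finset.mem_insert.1 hv with rfl | hvs
        · exact absurd huv (lt_irrefl _)
        · exact absurd huv (ha v hvs).not_gt
      · have hua := (ha u hus).ne
        rcases Finset.mem_insert.1 hv with rfl | hvs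
        · rw [Function.update_self, Function.update_of_ne hua]
          refine ⟨hlo _ ?_, fun hadj => hhi _ ?_, fun hadj => hlo _ ?_⟩
          · exact Finset.mem_union_left _ (Finset.mem_image_of_mem f hus)
          · exact Finset.mem_image_of_mem _ (Finset.mem_filter.2 ⟨hus, hadj⟩)
          · exact Finset.mem_union_right _
              (Finset.mem_image_of_mem _ (Finset.mem_filter.2 ⟨hus, hadj⟩))
        · rw [Function.update_of_ne (ha v hvs).ne, Function.update_of_ne hua]
          exact hf u hus v hvs huv
  obtain ⟨f, hf⟩ := key Finset.univ
  have hlt : ∀ u v : V, u < v → (G.Adj u v ↔ |f u - f v| ≤ 1) := by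
    intro u v huv
    obtain ⟨h₁, h₂, h₃⟩ := hf u (Finset.mem_univ u) v (Finset.mem_univ v) huv
    rw [abs_sub_comm, abs_of_pos (sub_pos.2 h₁)]
    refine ⟨fun hadj => by linarith [h₂ hadj], fun hle => ?_⟩
    by_contra hn
    linarith [h₃ hn]
  refine ⟨f, fun u v huv => ?_⟩
  rcases huv.lt_or_gt with huv | huv
  · exact hlt u v huv
  · rw [G.adj_comm, abs_sub_comm]
    exact hlt v u huv

/-- If the vertices of a finite graph are partitioned into cliques `Q 0, Q 1, …`, with edges only
inside or between consecutive cliques, and each clique carries a key along which the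
neighbourhoods in the previous clique decrease and those in the next clique increase, then the
graph is a unit interval graph. -/
theorem isUnitInterval_of_keys {V : Type*} [Finite V] (G : SimpleGraph V) (idx : V → ℕ)
    (hclique : ∀ u v, idx u = idx v → u ≠ v → G.Adj u v)
    (hfar : ∀ u v, idx u + 2 ≤ idx v → ¬ G.Adj u v) (k : V → ℤ)
    (hprev : ∀ u v w, idx u = idx v → idx w + 1 = idx u → k u ≤ k v → G.Adj v w → G.Adj u w)
    (hnext : ∀ u v w, idx u = idx v → idx w = idx u + 1 → k u ≤ k v → G.Adj u w → G.Adj v w) :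
    IsUnitInterval G := by
  obtain ⟨_, hmono⟩ := exists_linearOrder_monotone (fun v => toLex (idx v, k v))
  refine isUnitInterval_of_umbrella G fun u v w huv hvw huw => ?_
  have h₁ := Prod.Lex.toLex_le_toLex.1 (hmono huv.le)
  have h₂ := Prod.Lex.toLex_le_toLex.1 (hmono hvw.le)
  have hnear : idx w < idx u + 2 := not_le.1 fun h => hfar u w h huw
  simp only at h₁ h₂
  constructor
  · rcases eq_or_ne (idx u) (idx v) with h | h
    · exact hclique u v h huv.ne
    · exact (hprev v w u (by omega) (by omega) (by omega) huw.symm).symm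
  · rcases eq_or_ne (idx v) (idx w) with h | h
    · exact hclique v w h hvw.ne
    · exact hnext u v w (by omega) (by omega) (by omega) huw

/-- If the neighbourhoods in `t` of the vertices of `s` form a chain, then so do the neighbourhoods
in `s` of the vertices of `t`. -/
theorem neighborSet_inter_total_symm {V : Type*} (G : SimpleGraph V) {s t : Set V}
    (h : ∀ u ∈ s, ∀ v ∈ s, G.neighborSet u ∩ t ⊆ G.neighborSet v ∩ t ∨
      G.neighborSet v ∩ t ⊆ G.neighborSet u ∩ t) :
    ∀ u ∈ t, ∀ v ∈ t, G.neighborSet u ∩ s ⊆ G.neighborSet v ∩ s ∨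
      G.neighborSet v ∩ s ⊆ G.neighborSet u ∩ s := by
  intro u hu v hv
  by_contra! hn
  obtain ⟨x, ⟨hux, hx⟩, hvx⟩ := Set.not_subset.1 hn.1
  obtain ⟨y, ⟨hvy, hy⟩, huy⟩ := Set.not_subset.1 hn.2
  rcases h x hx y hy with hxy | hxy
  · exact huy ⟨G.adj_symm (hxy ⟨G.adj_symm hux, hu⟩).1, hy⟩
  · exact hvx ⟨G.adj_symm (hxy ⟨G.adj_symm hvy, hv⟩).1, hx⟩

/-- A finite connected graph is a unit interval graph iff its vertex
set can be partitioned into cliques `Q_0, …, Q_t` satisfying conditions (a), (b), (c). -/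
theorem unitInterval_iff_canonical_partition {V : Type} [Fintype V]
    (G : SimpleGraph V) (hconn : G.Connected) :
    IsUnitInterval G ↔
      ∃ (t : ℕ) (Q : ℕ → Set V),
        (∀ j, t < j → Q j = ∅) ∧
        (⋃ j, Q j) = Set.univ ∧
        (Pairwise fun i j => Disjoint (Q i) (Q j)) ∧
        (∀ j, G.IsClique (Q j)) ∧
        -- (a) vertices in non-consecutive cliques are non-adjacent
        (∀ i j : ℕ, (i + 2 ≤ j ∨ j + 2 ≤ i) →
          ∀ u ∈ Q i, ∀ v ∈ Q j, ¬ G.Adj u v) ∧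
        -- (b) neighbourhoods in the previous clique are comparable
        (∀ j : ℕ, 1 ≤ j → j ≤ t → ∀ u ∈ Q j, ∀ v ∈ Q j,
          (G.neighborSet u ∩ Q (j - 1) ⊆ G.neighborSet v ∩ Q (j - 1)) ∨
          (G.neighborSet v ∩ Q (j - 1) ⊆ G.neighborSet u ∩ Q (j - 1))) ∧
        -- (c) a linear order on `Q_j` decreasing in `G_j` and increasing in `G_{j+1}`
        (∀ j : ℕ, 1 ≤ j → j + 1 ≤ t →
          ∃ le : ↥(Q j) → ↥(Q j) → Prop, IsLinearOrder ↥(Q j) le ∧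
            ∀ u v : ↥(Q j), le u v →
              (G.neighborSet ↑v ∩ Q (j - 1) ⊆ G.neighborSet ↑u ∩ Q (j - 1)) ∧
              (G.neighborSet ↑u ∩ Q (j + 1) ⊆ G.neighborSet ↑v ∩ Q (j + 1))) := by
  constructor
  · rintro ⟨f, hf⟩
    obtain ⟨m, hm⟩ := (Set.finite_range f).bddBelow
    have hnonneg : ∀ v, 0 ≤ f v - m := fun v => sub_nonneg.2 (hm ⟨v, rfl⟩)
    obtain ⟨t, ht⟩ := (Set.finite_range fun v => ⌊f v - m⌋₊).bddAbove
    obtain ⟨_, hmono⟩ := exists_linearOrder_monotone f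
    have hQ : ∀ v j, v ∈ {v | ⌊f v - m⌋₊ = j} ↔ (j : ℝ) ≤ f v - m ∧ f v - m < j + 1 :=
      fun v j => Nat.floor_eq_iff (hnonneg v)
    have hclose : ∀ u v, u ≠ v → f u ≤ f v → (G.Adj u v ↔ f v ≤ f u + 1) := by
      intro u v huv hle
      rw [hf u v huv, abs_sub_comm, abs_of_nonneg (sub_nonneg.2 hle), sub_le_iff_le_add']
    have hfar : ∀ i j : ℕ, i + 2 ≤ j → ∀ u ∈ {v | ⌊f v - m⌋₊ = i},
        ∀ v ∈ {v | ⌊f v - m⌋₊ = j}, ¬ G.Adj u v := by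
      intro i j hij u hu v hv hadj
      have hu := (hQ u i).1 hu
      have hv := (hQ v j).1 hv
      have hij : (i : ℝ) + 2 ≤ j := by exact_mod_cast hij
      have := (hclose u v hadj.ne (by linarith)).1 hadj
      linarith
    have hprev : ∀ j : ℕ, 1 ≤ j → ∀ u ∈ {v | ⌊f v - m⌋₊ = j}, ∀ v ∈ {v | ⌊f v - m⌋₊ = j},
        f u ≤ f v → G.neighborSet v ∩ {v | ⌊f v - m⌋₊ = j - 1} ⊆
          G.neighborSet u ∩ {v | ⌊f v - m⌋₊ = j - 1} := by
      rintro j hj u hu v hv huv w ⟨hvw, hw⟩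
      refine ⟨?_, hw⟩
      have hu := (hQ u j).1 hu
      have hw := (hQ w (j - 1)).1 hw
      rw [Nat.cast_sub hj, Nat.cast_one, sub_add_cancel] at hw
      have hwu : f w < f u := by linarith
      have hwv := (hclose w v hvw.ne' (by linarith)).1 hvw.symm
      exact ((hclose w u (fun h => hwu.ne (congrArg f h)) hwu.le).2 (by linarith)).symm
    have hnext : ∀ j : ℕ, ∀ u ∈ {v | ⌊f v - m⌋₊ = j}, ∀ v ∈ {v | ⌊f v - m⌋₊ = j},
        f u ≤ f v → G.neighborSet u ∩ {v | ⌊f v - m⌋₊ = j + 1} ⊆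
          G.neighborSet v ∩ {v | ⌊f v - m⌋₊ = j + 1} := by
      rintro j u hu v hv huv w ⟨huw, hw⟩
      refine ⟨?_, hw⟩
      have hv := (hQ v j).1 hv
      have hw := (hQ w (j + 1)).1 hw
      rw [Nat.cast_add, Nat.cast_one] at hw
      have hvw : f v < f w := by linarith
      have huw := (hclose u w huw.ne (by linarith)).1 huw
      exact (hclose v w (fun h => hvw.ne (congrArg f h)) hvw.le).2 (by linarith)
    refine ⟨t, fun j => {v | ⌊f v - m⌋₊ = j}, ?_, ?_, ?_, ?_, ?_, ?_, ?_⟩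
    · refine fun j hj => Set.eq_empty_of_forall_notMem fun v hv => ?_
      have h₁ : ⌊f v - m⌋₊ ≤ t := ht ⟨v, rfl⟩
      have h₂ : ⌊f v - m⌋₊ = j := hv
      omega
    · exact Set.eq_univ_of_forall fun v => Set.mem_iUnion.2 ⟨_, rfl⟩
    · exact fun i j hij => Set.disjoint_left.2 fun v hi hj => hij (hi.symm.trans hj)
    · intro j u hu v hv huv
      have hu := (hQ u j).1 hu
      have hv := (hQ v j).1 hv
      exact (hf u v huv).2 (abs_le.2 ⟨by linarith, by linarith⟩)
    · rintro i j (hij | hij) u hu v hv hadj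
      · exact hfar i j hij u hu v hv hadj
      · exact hfar j i hij v hv u hu hadj.symm
    · intro j hj _ u hu v hv
      exact (le_total (f v) (f u)).imp (hprev j hj v hv u hu) (hprev j hj u hu v hv)
    · intro j hj _
      refine ⟨fun u v => u ≤ v, inferInstance, fun u v huv => ?_⟩
      exact ⟨hprev j hj u u.2 v v.2 (hmono huv), hnext j u u.2 v v.2 (hmono huv)⟩
  · rintro ⟨t, Q, hempty, hcover, hdisj, hclique, hfar, hchain, hord⟩
    have hmem : ∀ v, ∃ j, v ∈ Q j := fun v => Set.mem_iUnion.1 (hcover ▸ Set.mem_univ v)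
    choose idx hidx using hmem
    have hkey : ∀ j, ∃ k : V → ℤ, ∀ u ∈ Q j, ∀ v ∈ Q j, k u ≤ k v →
        (1 ≤ j → G.neighborSet v ∩ Q (j - 1) ⊆ G.neighborSet u ∩ Q (j - 1)) ∧
        G.neighborSet u ∩ Q (j + 1) ⊆ G.neighborSet v ∩ Q (j + 1) := by
      intro j
      rcases Nat.eq_zero_or_pos j with rfl | hj
      · have htotal : ∀ u ∈ Q 0, ∀ v ∈ Q 0,
            G.neighborSet u ∩ Q 1 ⊆ G.neighborSet v ∩ Q 1 ∨
            G.neighborSet v ∩ Q 1 ⊆ G.neighborSet u ∩ Q 1 := by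
          rcases Nat.eq_zero_or_pos t with rfl | ht
          · simp [hempty 1 one_pos]
          · exact neighborSet_inter_total_symm G (hchain 1 le_rfl ht)
        obtain ⟨k, hk⟩ := exists_key_of_total (Q 0) _ htotal
          fun u _ v _ w _ huv hvw => huv.trans hvw
        exact ⟨k, fun u hu v hv huv => ⟨fun h => absurd h (by omega), hk u hu v hv huv⟩⟩
      rcases lt_trichotomy j t with hjt | rfl | hjt
      · obtain ⟨le, hle, hmono⟩ := hord j hj hjt
        obtain ⟨k, hk⟩ := exists_key_of_total (Q j)
          (fun u v => ∃ (hu : u ∈ Q j) (hv : v ∈ Q j), le ⟨u, hu⟩ ⟨v, hv⟩)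
          (fun u hu v hv => (total_of le ⟨u, hu⟩ ⟨v, hv⟩).imp
            (fun h => ⟨hu, hv, h⟩) (fun h => ⟨hv, hu, h⟩))
          (fun u _ v _ w _ ⟨hu, _, huv⟩ ⟨_, hw, hvw⟩ => ⟨hu, hw, trans_of le huv hvw⟩)
        refine ⟨k, fun u hu v hv huv => ?_⟩
        obtain ⟨_, _, h⟩ := hk u hu v hv huv
        exact ⟨fun _ => (hmono _ _ h).1, (hmono _ _ h).2⟩
      · obtain ⟨k, hk⟩ := exists_key_of_total (Q j)
          (fun u v => G.neighborSet v ∩ Q (j - 1) ⊆ G.neighborSet u ∩ Q (j - 1))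
          (fun u hu v hv => (hchain j hj le_rfl u hu v hv).symm)
          (fun u _ v _ w _ huv hvw => hvw.trans huv)
        refine ⟨k, fun u hu v hv huv => ⟨fun _ => hk u hu v hv huv, ?_⟩⟩
        simp [hempty (j + 1) (Nat.lt_succ_self j)]
      · simp [hempty j hjt]
    choose k hk using hkey
    refine isUnitInterval_of_keys G idx (fun u v huv hne => ?_) (fun u v huv => ?_)
      (fun v => k (idx v) v) (fun u v w huv hw hle hadj => ?_) (fun u v w huv hw hle hadj => ?_)
    · exact hclique (idx v) (huv ▸ hidx u) (hidx v) hne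
    · exact hfar _ _ (Or.inl huv) u (hidx u) v (hidx v)
    · have hle : k (idx u) u ≤ k (idx u) v := huv ▸ hle
      have h := (hk (idx u) u (hidx u) v (huv ▸ hidx v) hle).1 (by omega)
      have hwQ : w ∈ Q (idx u - 1) := by
        rw [← hw]
        exact hidx w
      exact (h ⟨hadj, hwQ⟩).1
    · have hle : k (idx u) u ≤ k (idx u) v := huv ▸ hle
      have h := (hk (idx u) u (hidx u) v (huv ▸ hidx v) hle).2
      exact (h ⟨hadj, hw ▸ hidx w⟩).1
end

section
/- For all positive integers n and m, the canonical graph H_{n,m} is a unit interval graph. -/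
open SimpleGraph

/-- Order the vertices lexicographically by `m * row + column`: adjacency in `canonicalGraph n m`
means that two distinct vertices are at distance at most `m` in this order. -/
theorem canonicalGraph_adj_iff_abs_le {n m : ℕ} {u v : Fin n × Fin m} (huv : u ≠ v) :
    (canonicalGraph n m).Adj u v ↔
      |((m : ℤ) * (u.1 : ℕ) + (u.2 : ℕ)) - ((m : ℤ) * (v.1 : ℕ) + (v.2 : ℕ))| ≤ m := by
  obtain ⟨⟨i, hi⟩, ⟨j, hj⟩⟩ := u
  obtain ⟨⟨k, hk⟩, ⟨l, hl⟩⟩ := v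
  simp only [canonicalGraph, huv, ne_eq, not_false_eq_true, true_and, Fin.mk.injEq, abs_le]
  obtain h | h | h : i = k ∨ i < k ∨ k < i := by lia
  · subst h
    lia
  all_goals
    obtain ⟨d, rfl⟩ := Nat.exists_eq_add_of_lt h
    push_cast
    rcases Nat.eq_zero_or_pos d with rfl | hd
    · refine ⟨fun _ => ⟨?_, ?_⟩, fun ⟨_, _⟩ => ?_⟩ <;> lia
    · have hmd : (m : ℤ) ≤ m * d := le_mul_of_one_le_right (by positivity) (by exact_mod_cast hd)
      refine ⟨?_, fun ⟨_, _⟩ => ?_⟩ <;> lia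

/-- The canonical graph `H_{n,m}` is a unit interval graph. -/
theorem canonicalGraph_isUnitInterval (n m : ℕ) (hn : 0 < n) (hm : 0 < m) :
    IsUnitInterval (canonicalGraph n m) := by
  have hm' : (0 : ℝ) < m := by exact_mod_cast hm
  refine ⟨fun u => ((m : ℝ) * (u.1 : ℕ) + (u.2 : ℕ)) / m, fun u v huv => ?_⟩
  rw [canonicalGraph_adj_iff_abs_le huv, ← sub_div, abs_div, abs_of_pos hm', div_le_one hm']
  exact_mod_cast Iff.rfl
end

section
/- Let G be a finite connected unit interval graph with a representation f : V(G) → ℝ (distinct u, v adjacent iff |f(u) − f(v)| ≤ 1), and let p_0 be a vertex minimizing f. Then for every j ≥ 0, the set Q_j of vertices at graph distance exactly j from p_0 is a clique of G. -/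
open SimpleGraph

/-- In a connected unit interval graph, if `a` lies to the left of `u`, and `u` lies more than
one unit to the left of `v`, then every walk from `a` to `v` is longer than `G.dist a u`. -/
theorem dist_lt_walk_length_of_add_one_lt {V : Type*} {G : SimpleGraph V}
    (hconn : G.Connected) {f : V → ℝ}
    (hf : ∀ u v : V, u ≠ v → (G.Adj u v ↔ |f u - f v| ≤ 1)) {u a v : V}
    (p : G.Walk a v) (hau : f a ≤ f u) (huv : f u + 1 < f v) :
    G.dist a u < p.length := by
  induction p with
  | nil => linarith
  | @cons a b v hab q ih =>
    have hstep := abs_le.mp ((hf a b hab.ne).mp hab)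
    rw [Walk.length_cons]
    by_cases hbu : f b ≤ f u
    · have htail := ih hbu huv
      have htri := hconn.dist_triangle (u := a) (v := b) (w := u)
      rw [dist_eq_one_iff_adj.mpr hab] at htri
      omega
    · have hq : q.length ≠ 0 := fun h => by
        have := congrArg f (Walk.eq_of_length_eq_zero h)
        linarith
      have hdist : G.dist a u ≤ 1 := by
        by_cases h : a = u
        · simp [h]
        · exact (dist_eq_one_iff_adj.mpr ((hf a u h).mpr
            (abs_le.mpr ⟨by linarith, by linarith⟩))).le
      omega

/-- In a connected unit interval graph, the set of vertices at any
fixed distance from a vertex with leftmost interval is a clique. -/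
theorem distance_layer_isClique {V : Type} [Fintype V] (G : SimpleGraph V)
    (hconn : G.Connected) (f : V → ℝ)
    (hf : ∀ u v : V, u ≠ v → (G.Adj u v ↔ |f u - f v| ≤ 1))
    (p₀ : V) (hp₀ : ∀ v, f p₀ ≤ f v) (j : ℕ) :
    G.IsClique {v | G.dist p₀ v = j} := by
  have hle : ∀ u v : V, G.dist p₀ u = G.dist p₀ v → f v ≤ f u + 1 := by
    intro u v huv
    by_contra! h
    obtain ⟨p, hp⟩ := hconn.exists_walk_length_eq_dist p₀ v
    have := dist_lt_walk_length_of_add_one_lt hconn hf p (hp₀ u) h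
    omega
  intro u hu v hv hne
  have heq : G.dist p₀ u = G.dist p₀ v := hu.trans hv.symm
  have huv := hle u v heq
  have hvu := hle v u heq.symm
  exact (hf u v hne).mpr (abs_le.mpr ⟨by linarith, by linarith⟩)
end

section
/- Let G be a finite connected unit interval graph with a representation f : V(G) → ℝ (distinct u, v adjacent iff |f(u) − f(v)| ≤ 1), and let p_0 be a vertex minimizing f. If u and v are distinct non-adjacent vertices with f(u) < f(v), then the graph distance from p_0 to u is strictly smaller than the graph distance from p_0 to v. -/
open SimpleGraph

/-- In a connected unit interval graph, a walk starting at or to the left of `u` and ending more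
than one unit to the right of `u` is longer than the distance from its start to `u`. -/
theorem dist_lt_walk_length {V : Type*} {G : SimpleGraph V} (hconn : G.Connected) {f : V → ℝ}
    (hf : ∀ u v : V, u ≠ v → (G.Adj u v ↔ |f u - f v| ≤ 1)) {u a v : V} (p : G.Walk a v)
    (ha : f a ≤ f u) (hv : f u + 1 < f v) : G.dist a u < p.length := by
  induction p with
  | nil => linarith
  | @cons a b v hab q ih =>
    rw [Walk.length_cons]
    by_cases hb : f b ≤ f u
    · have hq := ih hb hv
      have htri : G.dist a u ≤ G.dist a b + G.dist b u := hconn.dist_triangle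
      have hone : G.dist a b = 1 := dist_eq_one_iff_adj.mpr hab
      omega
    · have habs := abs_le.mp ((hf a b hab.ne).mp hab)
      have hq : q.length ≠ 0 := by
        intro h
        have hbv := congrArg f (Walk.eq_of_length_eq_zero h)
        linarith
      by_cases hau : a = u
      · subst hau
        simp
      · have hadj : G.Adj a u := (hf a u hau).mpr (abs_le.mpr ⟨by linarith, by linarith⟩)
        have hone : G.dist a u = 1 := dist_eq_one_iff_adj.mpr hadj
        omega

/-- In a connected unit interval graph, if `u` and `v` are distinct
non-adjacent vertices with `f u < f v`, then `u` is closer than `v` to a vertex with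
leftmost interval. -/
theorem dist_lt_of_not_adj {V : Type} [Fintype V] (G : SimpleGraph V)
    (hconn : G.Connected) (f : V → ℝ)
    (hf : ∀ u v : V, u ≠ v → (G.Adj u v ↔ |f u - f v| ≤ 1))
    (p₀ : V) (hp₀ : ∀ v, f p₀ ≤ f v)
    (u v : V) (huv : u ≠ v) (hnadj : ¬ G.Adj u v) (hlt : f u < f v) :
    G.dist p₀ u < G.dist p₀ v := by
  obtain ⟨p, hp⟩ := hconn.exists_walk_length_eq_dist p₀ v
  rw [← hp]
  refine dist_lt_walk_length hconn hf p (hp₀ u) ?_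
  have hfar := not_le.mp (mt (hf u v huv).mpr hnadj)
  rw [abs_of_neg (sub_neg.mpr hlt)] at hfar
  linarith
end

section
/- Let G be a finite connected unit interval graph with a representation f : V(G) → ℝ (distinct u, v adjacent iff |f(u) − f(v)| ≤ 1), let p_0 be a vertex minimizing f, and for j ≥ 0 let Q_j be the set of vertices at graph distance exactly j from p_0. Then for every j ≥ 1, the bipartite relations between consecutive layers form a chain: there are no vertices x_1, x_2 ∈ Q_{j−1} and y_1, y_2 ∈ Q_j such that x_1 is adjacent to y_1, x_2 is adjacent to y_2, x_1 is not adjacent to y_2, and x_2 is not adjacent to y_1. Equivalently, for all u, v ∈ Q_j the sets N(u) ∩ Q_{j−1} and N(v) ∩ Q_{j−1} are comparable under inclusion. -/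
open SimpleGraph

/-- If `f u` is smaller than `f v`, then every walk from `v` to a minimizer `p` of a unit interval
representation `f` is at least as long as the distance from `u` to `p`. -/
theorem dist_le_length_of_lt {V : Type*} {G : SimpleGraph V} {f : V → ℝ}
    (hf : ∀ u v : V, u ≠ v → (G.Adj u v ↔ |f u - f v| ≤ 1)) {p u v : V}
    (hp : ∀ w, f p ≤ f w) (q : G.Walk v p) (huv : f u < f v) :
    G.dist u p ≤ q.length := by
  induction q with
  | nil => exact absurd huv (hp u).not_gt
  | @cons v w p hvw q ih =>
    rw [Walk.length_cons]
    rcases lt_or_ge (f u) (f w) with h | h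
    · exact (ih hp h).trans (Nat.le_succ _)
    · rcases eq_or_ne u w with rfl | hne
      · exact (dist_le q).trans (Nat.le_succ _)
      · have hvw' := abs_le.1 ((hf v w hvw.ne).1 hvw)
        have huw : G.Adj u w := (hf u w hne).2 (abs_le.2 ⟨by linarith, by linarith⟩)
        exact dist_le (Walk.cons huw q)

/-- A unit interval representation is monotone with respect to the distance from its minimizer. -/
theorem le_of_dist_lt {V : Type*} {G : SimpleGraph V} (hconn : G.Connected) {f : V → ℝ}
    (hf : ∀ u v : V, u ≠ v → (G.Adj u v ↔ |f u - f v| ≤ 1)) {p u v : V}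
    (hp : ∀ w, f p ≤ f w) (h : G.dist p u < G.dist p v) : f u ≤ f v := by
  by_contra! hlt
  obtain ⟨q, hq⟩ := hconn.exists_walk_length_eq_dist u p
  have hle := dist_le_length_of_lt hf hp q hlt
  rw [hq, dist_comm, dist_comm (u := u)] at hle
  omega

/-- A vertex `x` in an earlier layer that is adjacent to `v` is adjacent to every vertex `u` of a
later layer with `f u ≤ f v`. -/
theorem adj_of_adj_of_le {V : Type*} {G : SimpleGraph V} (hconn : G.Connected) {f : V → ℝ}
    (hf : ∀ u v : V, u ≠ v → (G.Adj u v ↔ |f u - f v| ≤ 1)) {p x u v : V}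
    (hp : ∀ w, f p ≤ f w) (hxu : G.dist p x < G.dist p u) (huv : f u ≤ f v)
    (hxv : G.Adj x v) : G.Adj x u := by
  have hle := le_of_dist_lt hconn hf hp hxu
  have hxv' := abs_le.1 ((hf x v hxv.ne).1 hxv)
  exact (hf x u (by rintro rfl; exact hxu.ne rfl)).2
    (abs_le.2 ⟨by linarith, by linarith⟩)

/-- Consecutive distance layers of a connected unit interval graph
induce a co-chain graph: no `2K₂` pattern between them, equivalently the
neighbourhoods in the previous layer are comparable. -/
theorem consecutive_layers_chain {V : Type} [Fintype V] (G : SimpleGraph V)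
    (hconn : G.Connected) (f : V → ℝ)
    (hf : ∀ u v : V, u ≠ v → (G.Adj u v ↔ |f u - f v| ≤ 1))
    (p₀ : V) (hp₀ : ∀ v, f p₀ ≤ f v) (j : ℕ) (hj : 1 ≤ j) :
    (¬ ∃ x₁ x₂ y₁ y₂ : V,
        G.dist p₀ x₁ = j - 1 ∧ G.dist p₀ x₂ = j - 1 ∧
        G.dist p₀ y₁ = j ∧ G.dist p₀ y₂ = j ∧
        G.Adj x₁ y₁ ∧ G.Adj x₂ y₂ ∧ ¬ G.Adj x₁ y₂ ∧ ¬ G.Adj x₂ y₁) ∧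
    (∀ u v : V, G.dist p₀ u = j → G.dist p₀ v = j →
      (G.neighborSet u ∩ {w | G.dist p₀ w = j - 1} ⊆
        G.neighborSet v ∩ {w | G.dist p₀ w = j - 1}) ∨
      (G.neighborSet v ∩ {w | G.dist p₀ w = j - 1} ⊆
        G.neighborSet u ∩ {w | G.dist p₀ w = j - 1})) := by
  have key : ∀ x u v : V, G.dist p₀ x = j - 1 → G.dist p₀ u = j → f u ≤ f v →
      G.Adj x v → G.Adj x u := fun x u v hx hu huv hxv =>
    adj_of_adj_of_le hconn hf hp₀ (by omega) huv hxv
  constructor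
  · rintro ⟨x₁, x₂, y₁, y₂, hx₁, hx₂, hy₁, hy₂, h₁, h₂, h₁₂, h₂₁⟩
    rcases le_total (f y₁) (f y₂) with h | h
    · exact h₂₁ (key x₂ y₁ y₂ hx₂ hy₁ h h₂)
    · exact h₁₂ (key x₁ y₂ y₁ hx₁ hy₂ h h₁)
  · intro u v hu hv
    rcases le_total (f u) (f v) with h | h
    · exact Or.inr fun w ⟨hvw, hw⟩ => ⟨(key w u v hw hu h hvw.symm).symm, hw⟩
    · exact Or.inl fun w ⟨huw, hw⟩ => ⟨(key w v u hw hv h huw.symm).symm, hw⟩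
end

section
/- Let G be a finite connected unit interval graph with a representation f : V(G) → ℝ (distinct u, v adjacent iff |f(u) − f(v)| ≤ 1), let p_0 be a vertex minimizing f, and for j ≥ 0 let Q_j be the set of vertices at graph distance exactly j from p_0. If j ≥ 1, Q_j is nonempty, and p is a vertex of Q_{j−1} maximizing f over Q_{j−1}, then p is adjacent to every vertex of Q_j. -/
open SimpleGraph

/-- Every vertex at positive distance `n + 1` from `a` has a neighbour at distance `n`. -/
theorem SimpleGraph.Connected.exists_adj_dist_eq {V : Type*} {G : SimpleGraph V}
    (hconn : G.Connected) {a v : V} {n : ℕ} (h : G.dist a v = n + 1) :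
    ∃ w, G.Adj w v ∧ G.dist a w = n := by
  obtain ⟨q, hq⟩ := hconn.exists_walk_length_eq_dist v a
  rw [G.dist_comm, h] at hq
  cases q with
  | nil => simp at hq
  | @cons _ w _ hadj q =>
    refine ⟨w, hadj.symm, ?_⟩
    have h₁ : G.dist a w ≤ n := by
      rw [G.dist_comm]
      exact (G.dist_le q).trans (by simpa using hq.le)
    have h₂ : G.dist a v ≤ G.dist a w + G.dist w v := hconn.dist_triangle
    rw [dist_eq_one_iff_adj.mpr hadj.symm] at h₂
    omega

/-- In a unit interval representation, a vertex to the left of a vertex at positive distance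
from a leftmost vertex is no farther from that leftmost vertex. -/
theorem dist_le_of_rep_le {V : Type*} {G : SimpleGraph V} (hconn : G.Connected) {f : V → ℝ}
    (hf : ∀ u v : V, u ≠ v → (G.Adj u v ↔ |f u - f v| ≤ 1))
    {p₀ : V} (hp₀ : ∀ v, f p₀ ≤ f v) {n : ℕ} {u v : V}
    (hv : G.dist p₀ v = n + 1) (huv : f u ≤ f v) : G.dist p₀ u ≤ n + 1 := by
  induction n generalizing v with
  | zero =>
    by_cases hu : p₀ = u
    · simp [← hu]
    · have hadj : G.Adj p₀ v := dist_eq_one_iff_adj.mp hv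
      have hv₁ := abs_le.mp ((hf _ _ hadj.ne).mp hadj)
      refine (dist_eq_one_iff_adj.mpr ((hf _ _ hu).mpr ?_)).le
      rw [abs_le]
      constructor <;> linarith [hp₀ u]
  | succ n ih =>
    obtain ⟨w, hadj, hw⟩ := hconn.exists_adj_dist_eq hv
    rcases le_or_gt (f u) (f w) with hle | hlt
    · exact (ih hw hle).trans (Nat.le_succ _)
    · have hne : w ≠ u := fun h => hlt.ne (congrArg f h)
      have hv₁ := abs_le.mp ((hf _ _ hadj.ne).mp hadj)
      have hwu : G.Adj w u := (hf _ _ hne).mpr (abs_le.mpr ⟨by linarith, by linarith⟩)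
      have htri : G.dist p₀ u ≤ G.dist p₀ w + G.dist w u := hconn.dist_triangle
      rwa [hw, dist_eq_one_iff_adj.mpr hwu] at htri

/-- A vertex with rightmost interval in layer `Q_{j-1}` is adjacent
to every vertex of layer `Q_j`. -/
theorem rightmost_adj_next_layer {V : Type} [Fintype V] (G : SimpleGraph V)
    (hconn : G.Connected) (f : V → ℝ)
    (hf : ∀ u v : V, u ≠ v → (G.Adj u v ↔ |f u - f v| ≤ 1))
    (p₀ : V) (hp₀ : ∀ v, f p₀ ≤ f v) (j : ℕ) (hj : 1 ≤ j)
    (hne : {v | G.dist p₀ v = j}.Nonempty)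
    (p : V) (hp : G.dist p₀ p = j - 1)
    (hmax : ∀ v, G.dist p₀ v = j - 1 → f v ≤ f p) :
    ∀ v, G.dist p₀ v = j → G.Adj p v := by
  intro v hv
  obtain ⟨n, rfl⟩ := Nat.exists_eq_add_of_le' hj
  rw [Nat.add_sub_cancel] at hp hmax
  cases n with
  | zero =>
    rw [← hconn.dist_eq_zero_iff.mp hp]
    exact dist_eq_one_iff_adj.mp hv
  | succ n =>
    obtain ⟨w, hadj, hw⟩ := hconn.exists_adj_dist_eq hv
    have hwp := hmax w hw
    have hpv : f p < f v := by
      by_contra! hle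
      have := dist_le_of_rep_le hconn hf hp₀ hp hle
      omega
    have hwv := abs_le.mp ((hf _ _ hadj.ne).mp hadj)
    have hne' : p ≠ v := fun h => hpv.ne (congrArg f h)
    exact (hf _ _ hne').mpr (abs_le.mpr ⟨by linarith, by linarith⟩)
end

section
/- Let G be a finite connected unit interval graph with a representation f : V(G) → ℝ (distinct u, v adjacent iff |f(u) − f(v)| ≤ 1), let p_0 be a vertex minimizing f, and for j ≥ 0 let Q_j be the set of vertices at graph distance exactly j from p_0. If j ≥ 1 and p is a vertex of Q_{j−1} maximizing f over Q_{j−1}, then f(p) ≤ f(v) for every vertex v whose graph distance from p_0 is at least j. -/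
open SimpleGraph

/-- In a connected unit interval graph, a vertex positioned between the endpoints of a walk
is no further from the start of the walk than the walk is long. -/
theorem dist_le_length_of_between {V : Type*} {G : SimpleGraph V}
    (hconn : G.Connected) {f : V → ℝ}
    (hf : ∀ u v : V, u ≠ v → (G.Adj u v ↔ |f u - f v| ≤ 1)) (v : V) {u p : V}
    (w : G.Walk u p) (huv : f u ≤ f v) (hvp : f v < f p) :
    G.dist u v ≤ w.length := by
  induction w with
  | nil => exact absurd hvp huv.not_gt
  | @cons a b c hab w ih =>
    rw [Walk.length_cons]
    by_cases hb : f b ≤ f v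
    · have htri := hconn.dist_triangle (u := a) (v := b) (w := v)
      have hdist : G.dist a b = 1 := dist_eq_one_iff_adj.mpr hab
      have hbv := ih hb hvp
      omega
    · rcases eq_or_ne a v with rfl | hne
      · simp
      · have hav : G.Adj a v := by
          have habs := abs_le.mp ((hf a b hab.ne).mp hab)
          exact (hf a v hne).mpr (abs_le.mpr ⟨by linarith, by linarith⟩)
        have hdist : G.dist a v = 1 := dist_eq_one_iff_adj.mpr hav
        omega

/-- A vertex with rightmost interval in layer `Q_{j-1}` has its
interval to the left of the interval of every vertex at distance at least `j`. -/
theorem rightmost_le_further_layers {V : Type} [Fintype V] (G : SimpleGraph V)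
    (hconn : G.Connected) (f : V → ℝ)
    (hf : ∀ u v : V, u ≠ v → (G.Adj u v ↔ |f u - f v| ≤ 1))
    (p₀ : V) (hp₀ : ∀ v, f p₀ ≤ f v) (j : ℕ) (hj : 1 ≤ j)
    (p : V) (hp : G.dist p₀ p = j - 1)
    (hmax : ∀ v, G.dist p₀ v = j - 1 → f v ≤ f p) :
    ∀ v, j ≤ G.dist p₀ v → f p ≤ f v := by
  intro v hv
  by_contra! hlt
  obtain ⟨w, hw⟩ := hconn.exists_walk_length_eq_dist p₀ p
  have hle := dist_le_length_of_between hconn hf v w (hp₀ v) hlt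
  omega
end

section
/- Let G be a finite connected unit interval graph with a representation f : V(G) → ℝ (distinct u, v adjacent iff |f(u) − f(v)| ≤ 1), let p_0 be a vertex minimizing f, and for j ≥ 0 let Q_j be the set of vertices at graph distance exactly j from p_0. Then for every j ≥ 1 and all u, v ∈ Q_j: if N(u) ∩ Q_{j−1} is a proper subset of N(v) ∩ Q_{j−1}, then N(v) ∩ Q_{j+1} ⊆ N(u) ∩ Q_{j+1}. -/
open SimpleGraph

/-- In a connected graph whose edges are exactly the pairs at `f`-distance at most `1`, a vertex
whose value lies between the values at the ends of a walk is no farther from the start than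
the length of the walk. -/
theorem dist_le_length_of_le_of_lt {V : Type*} {G : SimpleGraph V} (hconn : G.Connected)
    {f : V → ℝ} (hf : ∀ u v : V, u ≠ v → (G.Adj u v ↔ |f u - f v| ≤ 1)) {x a b : V}
    (p : G.Walk x a) (hxb : f x ≤ f b) (hba : f b < f a) : G.dist x b ≤ p.length := by
  induction p with
  | nil => exact absurd hba hxb.not_gt
  | @cons x y a hxy p ih =>
    rw [Walk.length_cons]
    have hxy_dist : G.dist x y = 1 := dist_eq_one_iff_adj.2 hxy
    rcases le_or_gt (f y) (f b) with hyb | hby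
    · have := ih hyb hba
      have := hconn.dist_triangle (u := x) (v := y) (w := b)
      omega
    · rcases eq_or_ne x b with rfl | hne
      · simp
      · have hxy_le := abs_le.1 ((hf x y hxy.ne).1 hxy)
        have hadj : G.Adj x b := (hf x b hne).2 (abs_le.2 ⟨by linarith, by linarith⟩)
        have := dist_eq_one_iff_adj.2 hadj
        omega

/-- Along a unit interval representation, distance layers from a leftmost vertex are ordered. -/
theorem le_of_dist_lt_dist {V : Type*} {G : SimpleGraph V} (hconn : G.Connected)
    {f : V → ℝ} (hf : ∀ u v : V, u ≠ v → (G.Adj u v ↔ |f u - f v| ≤ 1)) {p₀ a b : V}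
    (hp₀ : ∀ v, f p₀ ≤ f v) (hab : G.dist p₀ a < G.dist p₀ b) : f a ≤ f b := by
  by_contra! hba
  obtain ⟨p, hp⟩ := hconn.exists_walk_length_eq_dist p₀ a
  have := dist_le_length_of_le_of_lt hconn hf p (hp₀ b) hba
  omega

/-- For vertices `u, v` in layer `Q_j`, if the neighbourhood of `u`
in `Q_{j-1}` is strictly contained in that of `v`, then the neighbourhood of `v` in
`Q_{j+1}` is contained in that of `u`. -/
theorem neighborhoods_reverse_in_next_layer {V : Type} [Fintype V]
    (G : SimpleGraph V) (hconn : G.Connected) (f : V → ℝ)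
    (hf : ∀ u v : V, u ≠ v → (G.Adj u v ↔ |f u - f v| ≤ 1))
    (p₀ : V) (hp₀ : ∀ v, f p₀ ≤ f v) (j : ℕ) (hj : 1 ≤ j)
    (u v : V) (hu : G.dist p₀ u = j) (hv : G.dist p₀ v = j)
    (hsub : G.neighborSet u ∩ {w | G.dist p₀ w = j - 1} ⊂
            G.neighborSet v ∩ {w | G.dist p₀ w = j - 1}) :
    G.neighborSet v ∩ {w | G.dist p₀ w = j + 1} ⊆
      G.neighborSet u ∩ {w | G.dist p₀ w = j + 1} := by
  obtain ⟨w, ⟨hvw, hw⟩, hwu⟩ := Set.exists_of_ssubset hsub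
  rintro x ⟨hvx, hx⟩
  simp only [Set.mem_inter_iff, mem_neighborSet, Set.mem_ofPred_eq] at *
  have huw : u ≠ w := by rintro rfl; omega
  have hux : u ≠ x := by rintro rfl; omega
  have hfwu : f w ≤ f u := le_of_dist_lt_dist hconn hf hp₀ (by omega)
  have hfux : f u ≤ f x := le_of_dist_lt_dist hconn hf hp₀ (by omega)
  have hfuw : 1 < f u - f w := by
    by_contra! h
    exact hwu ⟨(hf u w huw).2 (abs_le.2 ⟨by linarith, h⟩), hw⟩
  have hfvw := abs_le.1 ((hf v w hvw.ne).1 hvw)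
  have hfvx := abs_le.1 ((hf v x hvx.ne).1 hvx)
  exact ⟨(hf u x hux).2 (abs_le.2 ⟨by linarith, by linarith⟩), hx⟩
end

section
/- For all positive integers s, t and every i with 1 ≤ i ≤ t, let U_i be the set of vertices of the canonical graph H_{s,t} lying in the first i columns, i.e., U_i = {(a,b) : 1 ≤ a ≤ s, 1 ≤ b ≤ i}. Then any two vertices of U_i in the same row have the same neighborhood outside U_i; consequently μ_{H_{s,t}}(U_i) ≤ s. -/
open SimpleGraph

/-- A vertex `p` and a vertex `w` in a strictly later column of the canonical graph are
adjacent iff `w` lies in the row of `p` or in the row just before it. -/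
theorem canonicalGraph_adj_iff_of_col_lt {s t : ℕ} {p w : Fin s × Fin t}
    (h : (p.2 : ℕ) < w.2) :
    (canonicalGraph s t).Adj p w ↔ p.1 = w.1 ∨ (p.1 : ℕ) = (w.1 : ℕ) + 1 := by
  have hne : p ≠ w := by
    rintro rfl
    exact lt_irrefl _ h
  simp only [canonicalGraph, ne_eq, hne, not_false_eq_true, h.le, h.not_ge, true_and, and_true,
    and_false, false_or]

/-- If similarity of vertices of `U` is implied by equality of their values under a map to
`Fin s`, then `U` has at most `s` similarity classes. -/
theorem mu_le_of_fiberwise_similar {V : Type*} {G : SimpleGraph V} {U : Set V} {s : ℕ}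
    (f : V → Fin s)
    (h : ∀ u ∈ U, ∀ v ∈ U, f u = f v → ∀ w ∉ U, (G.Adj u w ↔ G.Adj v w)) :
    mu G U ≤ s := by
  have hinj : Function.Injective
      (fun c : Quotient (similarSetoid G U) => f (Quotient.out c : U)) := by
    intro c d hcd
    rw [← Quotient.out_eq c, ← Quotient.out_eq d]
    exact Quotient.sound (h _ (Quotient.out c).2 _ (Quotient.out d).2 hcd)
  simpa [mu] using Nat.card_le_card_of_injective _ hinj

/-- In `H_{s,t}`, any two vertices of the first `i` columns lying in
the same row have the same neighbourhood outside the first `i` columns; consequently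
`μ(U_i) ≤ s` where `U_i` is the set of vertices of the first `i` columns. -/
theorem canonicalGraph_columns_mu_le (s t : ℕ) (hs : 0 < s) (ht : 0 < t)
    (i : ℕ) (hi1 : 1 ≤ i) (hit : i ≤ t) :
    (∀ p q : Fin s × Fin t, (p.2 : ℕ) < i → (q.2 : ℕ) < i → p.1 = q.1 →
      ∀ w : Fin s × Fin t, ¬ ((w.2 : ℕ) < i) →
        ((canonicalGraph s t).Adj p w ↔ (canonicalGraph s t).Adj q w)) ∧
    mu (canonicalGraph s t) {p : Fin s × Fin t | (p.2 : ℕ) < i} ≤ s := by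
  have key : ∀ p q : Fin s × Fin t, (p.2 : ℕ) < i → (q.2 : ℕ) < i → p.1 = q.1 →
      ∀ w : Fin s × Fin t, ¬ ((w.2 : ℕ) < i) →
        ((canonicalGraph s t).Adj p w ↔ (canonicalGraph s t).Adj q w) := by
    intro p q hp hq hpq w hw
    rw [canonicalGraph_adj_iff_of_col_lt (hp.trans_le (not_lt.mp hw)),
      canonicalGraph_adj_iff_of_col_lt (hq.trans_le (not_lt.mp hw)), hpq]
  exact ⟨key, mu_le_of_fiberwise_similar Prod.fst fun p hp q hq => key p q hp hq⟩
end

section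
/- Let k_1, k_2 be positive integers and n = k_1 + k_2. If a graph G_1 is an induced subgraph of the canonical graph H_{k_1,k_1} and a graph G_2 is an induced subgraph of the canonical graph H_{k_2,k_2}, then the disjoint union of G_1 and G_2 is an induced subgraph of the canonical graph H_{n,n}. In particular, the subgraph of H_{n,n} induced by the intersection of the first k_1 rows with the first k_1 columns is isomorphic to H_{k_1,k_1}, the subgraph induced by the intersection of the last k_2 rows with the last k_2 columns is isomorphic to H_{k_2,k_2}, and no vertex of the former set is adjacent to a vertex of the latter. -/
open SimpleGraph

/-- The embedding of `H_{k,k}` into `H_{n,n}` that translates both coordinates by `a`. -/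
def canonicalGraphShift {k n : ℕ} (a : ℕ) (h : a + k ≤ n) :
    canonicalGraph k k ↪g canonicalGraph n n where
  toFun p := (⟨a + p.1, by omega⟩, ⟨a + p.2, by omega⟩)
  inj' := by
    rintro ⟨i, j⟩ ⟨i', j'⟩ hp
    simpa [Fin.ext_iff] using hp
  map_rel_iff' := by
    rintro ⟨i, j⟩ ⟨i', j'⟩
    change (canonicalGraph n n).Adj (⟨a + i, by omega⟩, ⟨a + j, by omega⟩)
      (⟨a + i', by omega⟩, ⟨a + j', by omega⟩) ↔ _
    simp only [canonicalGraph, ne_eq, Prod.mk.injEq, Fin.ext_iff]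
    omega

lemma canonicalGraphShift_apply {k n : ℕ} (a : ℕ) (h : a + k ≤ n) (p : Fin k × Fin k) :
    canonicalGraphShift a h p = (⟨a + p.1, by omega⟩, ⟨a + p.2, by omega⟩) :=
  rfl

lemma mem_range_canonicalGraphShift {k n : ℕ} (a : ℕ) (h : a + k ≤ n) (p : Fin n × Fin n) :
    p ∈ Set.range (canonicalGraphShift a h) ↔
      (a ≤ (p.1 : ℕ) ∧ (p.1 : ℕ) < a + k) ∧ a ≤ (p.2 : ℕ) ∧ (p.2 : ℕ) < a + k := by
  constructor
  · rintro ⟨⟨i, j⟩, rfl⟩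
    simp [canonicalGraphShift_apply]
  · obtain ⟨i, j⟩ := p
    rintro ⟨⟨hi, hi'⟩, hj, hj'⟩
    simp only at hi hi' hj hj'
    refine ⟨(⟨i - a, by omega⟩, ⟨j - a, by omega⟩), ?_⟩
    simp only [canonicalGraphShift_apply, Prod.mk.injEq, Fin.ext_iff]
    omega

lemma nonempty_induce_iso_of_eq_range {V W : Type*} {G : SimpleGraph V} {H : SimpleGraph W}
    (f : G ↪g H) {s : Set W} (hs : s = Set.range f) : Nonempty (H.induce s ≃g G) := by
  subst hs
  exact ⟨f.isoInduceRange.symm⟩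

lemma canonicalGraph_not_adj_of_lt_of_le {n k : ℕ} {p q : Fin n × Fin n}
    (hp : (p.1 : ℕ) < k ∧ (p.2 : ℕ) < k) (hq : k ≤ (q.1 : ℕ) ∧ k ≤ (q.2 : ℕ)) :
    ¬ (canonicalGraph n n).Adj p q := by
  rintro ⟨-, h⟩
  rw [Fin.ext_iff] at h
  omega

/-- Embeddings of two graphs whose images are disjoint and have no edges between them
combine to an embedding of the disjoint union. -/
def sumEmbedding {U V W : Type*} {G : SimpleGraph U} {G' : SimpleGraph V} {H : SimpleGraph W}
    (f : G ↪g H) (g : G' ↪g H) (hne : ∀ u v, f u ≠ g v) (hadj : ∀ u v, ¬ H.Adj (f u) (g v)) :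
    (G ⊕g G') ↪g H where
  toFun := Sum.elim f g
  inj' := f.injective.sumElim g.injective hne
  map_rel_iff' := by
    rintro (u | u) (v | v)
    · simp
    · simpa using hadj u v
    · simpa [H.adj_comm] using hadj v u
    · simp

/-- The disjoint union pattern inside `H_{n,n}` for `n = k₁ + k₂`. -/
theorem canonicalGraph_disjoint_union (k₁ k₂ : ℕ) (hk₁ : 0 < k₁) (hk₂ : 0 < k₂)
    (n : ℕ) (hn : n = k₁ + k₂)
    {α β : Type} (G₁ : SimpleGraph α) (G₂ : SimpleGraph β)
    (h₁ : Nonempty (G₁ ↪g canonicalGraph k₁ k₁))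
    (h₂ : Nonempty (G₂ ↪g canonicalGraph k₂ k₂)) :
    Nonempty ((G₁ ⊕g G₂) ↪g canonicalGraph n n) ∧
    Nonempty (((canonicalGraph n n).induce
        {p : Fin n × Fin n | (p.1 : ℕ) < k₁ ∧ (p.2 : ℕ) < k₁}) ≃g canonicalGraph k₁ k₁) ∧
    Nonempty (((canonicalGraph n n).induce
        {p : Fin n × Fin n | k₁ ≤ (p.1 : ℕ) ∧ k₁ ≤ (p.2 : ℕ)}) ≃g canonicalGraph k₂ k₂) ∧
    (∀ p q : Fin n × Fin n, ((p.1 : ℕ) < k₁ ∧ (p.2 : ℕ) < k₁) →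
      (k₁ ≤ (q.1 : ℕ) ∧ k₁ ≤ (q.2 : ℕ)) → ¬ (canonicalGraph n n).Adj p q) := by
  subst hn
  obtain ⟨f₁⟩ := h₁
  obtain ⟨f₂⟩ := h₂
  let s₁ := canonicalGraphShift (k := k₁) (n := k₁ + k₂) 0 (by omega)
  let s₂ := canonicalGraphShift (k := k₂) (n := k₁ + k₂) k₁ le_rfl
  have hs₁ : ∀ p, p ∈ Set.range s₁ ↔ (p.1 : ℕ) < k₁ ∧ (p.2 : ℕ) < k₁ := fun p ↦ by
    simpa using mem_range_canonicalGraphShift 0 (by omega) p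
  have hs₂ : ∀ p, p ∈ Set.range s₂ ↔ k₁ ≤ (p.1 : ℕ) ∧ k₁ ≤ (p.2 : ℕ) := fun p ↦ by
    simpa using mem_range_canonicalGraphShift k₁ le_rfl p
  have mem₁ (u : α) := (hs₁ _).1 ⟨f₁ u, rfl⟩
  have mem₂ (v : β) := (hs₂ _).1 ⟨f₂ v, rfl⟩
  refine ⟨⟨sumEmbedding (f₁.trans s₁) (f₂.trans s₂) (fun u v h ↦ ?_) fun u v ↦
      canonicalGraph_not_adj_of_lt_of_le (mem₁ u) (mem₂ v)⟩,
    nonempty_induce_iso_of_eq_range s₁ (Set.ext fun p ↦ (hs₁ p).symm),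
    nonempty_induce_iso_of_eq_range s₂ (Set.ext fun p ↦ (hs₂ p).symm),
    fun _ _ ↦ canonicalGraph_not_adj_of_lt_of_le⟩
  have hu := (mem₁ u).1
  have hv := (mem₂ v).1
  change s₁ (f₁ u) = s₂ (f₂ v) at h
  rw [h] at hu
  omega
end
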